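/- arXiv:1911.05233 — 5 statements merged into one kernel-verified Lean document; each statement's English description precedes it below -/
import Mathlib

section
/- Let λ > 0, let I be a nonempty finite index set, let a ∈ ℂ, and for each i ∈ I let uᵢ : ℝ → ℂ be twice continuously differentiable with uᵢ''(z) = −λuᵢ(z) on [0,1], uᵢ(0) = a, and suppose the Kirchhoff condition ∑_{i∈I} uᵢ'(0) = 0 holds. Then ∑_{i∈I} uᵢ(1) = (card I)·cos(√λ)·a. -/
/-- The value at `1` of a solution of `v'' = -s² v` on `[0, 1]`, in terms of its Cauchy data
at `0`. -/
theorem mul_apply_one_of_deriv_deriv_eq_neg_sq_mul {s : ℝ} {v : ℝ → ℂ} (hv : ContDiff ℝ 2 v)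
    (hode : ∀ z ∈ Set.Icc (0:ℝ) 1, deriv (deriv v) z = -(s : ℂ) ^ 2 * v z) :
    (s : ℂ) * v 1 = s * (Real.cos s : ℂ) * v 0 + (Real.sin s : ℂ) * deriv v 0 := by
  have hv' : Differentiable ℝ v := hv.differentiable (by norm_num)
  have hv'' : Differentiable ℝ (deriv v) := by
    have h : ContDiff ℝ (1 + 1) v := by simpa [one_add_one_eq_two] using hv
    exact (contDiff_succ_iff_deriv.1 h).2.2.differentiable (by norm_num)
  let F : ℝ → ℂ := fun z ↦ s * (Real.cos (s * (1 - z)) : ℂ) * v z +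
    (Real.sin (s * (1 - z)) : ℂ) * deriv v z
  have hF : ∀ z ∈ Set.Icc (0:ℝ) 1, HasDerivAt F 0 z := by
    intro z hz
    have harg : HasDerivAt (fun z : ℝ ↦ s * (1 - z)) (-s) z := by
      simpa using ((hasDerivAt_id z).const_sub 1).const_mul s
    have h := ((harg.cos.ofReal_comp.const_mul (s : ℂ)).mul (hv' z).hasDerivAt).add
      (harg.sin.ofReal_comp.mul (hv'' z).hasDerivAt)
    refine h.congr_deriv ?_
    rw [hode z hz]
    push_cast
    ring
  have hconst := constant_of_has_deriv_right_zero
    (fun z hz ↦ (hF z hz).continuousAt.continuousWithinAt)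
    (fun z hz ↦ (hF z (Set.Ico_subset_Icc_self hz)).hasDerivWithinAt)
    1 (Set.right_mem_Icc.2 zero_le_one)
  simpa [F] using hconst

/-- Single-vertex reduction from the free edge Laplacian to the vertex Laplacian:
if the edge solutions at a vertex satisfy the Kirchhoff condition, then
`∑ uᵢ(1) = (card I) cos(√λ) a`. -/
theorem stmt_11 (lam : ℝ) (hlam : 0 < lam)
    (I : Type*) [Fintype I] [Nonempty I] (a : ℂ) (u : I → ℝ → ℂ)
    (hu : ∀ i, ContDiff ℝ 2 (u i))
    (hode : ∀ i, ∀ z ∈ Set.Icc (0:ℝ) 1, deriv (deriv (u i)) z = -(lam : ℂ) * u i z)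
    (h0 : ∀ i, u i 0 = a)
    (hK : ∑ i, deriv (u i) 0 = 0) :
    ∑ i, u i 1 = (Fintype.card I : ℂ) * (Real.cos (Real.sqrt lam) : ℂ) * a := by
  have hs : (Real.sqrt lam : ℂ) ≠ 0 := by
    exact_mod_cast (Real.sqrt_pos.2 hlam).ne'
  have hsq : (Real.sqrt lam : ℂ) ^ 2 = lam := by
    exact_mod_cast Real.sq_sqrt hlam.le
  apply mul_left_cancel₀ hs
  calc (Real.sqrt lam : ℂ) * ∑ i, u i 1
      = ∑ i, ((Real.sqrt lam : ℂ) * (Real.cos (Real.sqrt lam) : ℂ) * a +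
          (Real.sin (Real.sqrt lam) : ℂ) * deriv (u i) 0) := by
        rw [Finset.mul_sum]
        refine Finset.sum_congr rfl fun i _ ↦ ?_
        rw [← h0 i]
        exact mul_apply_one_of_deriv_deriv_eq_neg_sq_mul (hu i) (by simpa only [hsq] using hode i)
    _ = _ := by
        rw [Finset.sum_add_distrib, ← Finset.mul_sum _ _ (Real.sin _ : ℂ), hK, Finset.sum_const, Finset.card_univ,
          nsmul_eq_mul]
        ring
end

section
/- Let λ ∈ ℝ, let I be a nonempty finite index set, and for each i ∈ I let qᵢ : ℝ → ℝ be continuous and let φᵢ, χᵢ : ℝ → ℝ be twice continuously differentiable solutions of −φ'' + qᵢφ = λφ on [0,1] with φᵢ(0) = 0, φᵢ'(0) = 1, χᵢ(0) = 1, χᵢ'(0) = 0, and assume φᵢ(1) ≠ 0 for every i. Let a ∈ ℂ and for each i let uᵢ : ℝ → ℂ be twice continuously differentiable with −uᵢ'' + qᵢuᵢ = λuᵢ on [0,1], uᵢ(0) = a, and suppose ∑_{i∈I} uᵢ'(0) = 0. Then ∑_{i∈I} uᵢ(1)/φᵢ(1) = a · ∑_{i∈I} χᵢ(1)/φᵢ(1).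 -/
/-- The Wronskian of two solutions of `f'' = p f` on `[a, b]` takes the same value at both
endpoints. -/
theorem wronskian_eq_of_schrodinger {a b : ℝ} (hab : a ≤ b) {p f f' g g' : ℝ → ℂ}
    (hf : ∀ z ∈ Set.Icc a b, HasDerivAt f (f' z) z)
    (hf' : ∀ z ∈ Set.Icc a b, HasDerivAt f' (p z * f z) z)
    (hg : ∀ z ∈ Set.Icc a b, HasDerivAt g (g' z) z)
    (hg' : ∀ z ∈ Set.Icc a b, HasDerivAt g' (p z * g z) z) :
    f b * g' b - f' b * g b = f a * g' a - f' a * g a := by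
  have hW : ∀ z ∈ Set.Icc a b, HasDerivAt (fun z => f z * g' z - f' z * g z) 0 z := by
    intro z hz
    refine (((hf z hz).fun_mul (hg' z hz)).fun_sub
      ((hf' z hz).fun_mul (hg z hz))).congr_deriv ?_
    ring
  exact constant_of_has_deriv_right_zero (fun z hz => (hW z hz).continuousAt.continuousWithinAt)
    (fun z hz => (hW z (Set.Ico_subset_Icc_self hz)).hasDerivWithinAt) b
    (Set.right_mem_Icc.mpr hab)

/-- A solution of `u'' = p u` is the combination of the fundamental solutions `χ` and `φ` with
coefficients given by its initial data. -/
theorem eq_fundamental_solutions_combination {a b : ℝ} (hab : a ≤ b)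
    {p u u' φ φ' χ χ' : ℝ → ℂ}
    (hu : ∀ z ∈ Set.Icc a b, HasDerivAt u (u' z) z)
    (hu' : ∀ z ∈ Set.Icc a b, HasDerivAt u' (p z * u z) z)
    (hφ : ∀ z ∈ Set.Icc a b, HasDerivAt φ (φ' z) z)
    (hφ' : ∀ z ∈ Set.Icc a b, HasDerivAt φ' (p z * φ z) z)
    (hχ : ∀ z ∈ Set.Icc a b, HasDerivAt χ (χ' z) z)
    (hχ' : ∀ z ∈ Set.Icc a b, HasDerivAt χ' (p z * χ z) z)
    (hφa : φ a = 0) (hφa' : φ' a = 1) (hχa : χ a = 1) (hχa' : χ' a = 0) :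
    u b = u a * χ b + u' a * φ b := by
  have h₁ := wronskian_eq_of_schrodinger hab hu hu' hφ hφ'
  have h₂ := wronskian_eq_of_schrodinger hab hu hu' hχ hχ'
  have h₃ := wronskian_eq_of_schrodinger hab hχ hχ' hφ hφ'
  rw [hφa, hφa'] at h₁ h₃
  rw [hχa, hχa'] at h₂ h₃
  linear_combination χ b * h₁ - φ b * h₂ - u b * h₃

theorem ContDiff.hasDerivAt_deriv_of_two {E : Type*} [NormedAddCommGroup E] [NormedSpace ℝ E]
    {f : ℝ → E} (hf : ContDiff ℝ 2 f) (z : ℝ) :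
    HasDerivAt f (deriv f z) z ∧ HasDerivAt (deriv f) (deriv (deriv f) z) z :=
  ⟨(hf.differentiable (by norm_num) z).hasDerivAt,
    (hf.differentiable_deriv_two z).hasDerivAt⟩


/-- Single-vertex reduction from the edge Schrödinger operator to the vertex
Schrödinger operator: `∑ uᵢ(1)/φᵢ(1) = a ∑ χᵢ(1)/φᵢ(1)`. -/
theorem stmt_12 (lam : ℝ) (I : Type*) [Fintype I] [Nonempty I]
    (q : I → ℝ → ℝ) (hq : ∀ i, Continuous (q i))
    (φ χ : I → ℝ → ℝ)
    (hφ : ∀ i, ContDiff ℝ 2 (φ i)) (hχ : ∀ i, ContDiff ℝ 2 (χ i))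
    (hodeφ : ∀ i, ∀ z ∈ Set.Icc (0:ℝ) 1,
      -(deriv (deriv (φ i)) z) + q i z * φ i z = lam * φ i z)
    (hodeχ : ∀ i, ∀ z ∈ Set.Icc (0:ℝ) 1,
      -(deriv (deriv (χ i)) z) + q i z * χ i z = lam * χ i z)
    (hφ0 : ∀ i, φ i 0 = 0) (hφ0' : ∀ i, deriv (φ i) 0 = 1)
    (hχ0 : ∀ i, χ i 0 = 1) (hχ0' : ∀ i, deriv (χ i) 0 = 0)
    (hφ1 : ∀ i, φ i 1 ≠ 0)
    (a : ℂ) (u : I → ℝ → ℂ)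
    (hu : ∀ i, ContDiff ℝ 2 (u i))
    (hode : ∀ i, ∀ z ∈ Set.Icc (0:ℝ) 1,
      -(deriv (deriv (u i)) z) + (q i z : ℂ) * u i z = (lam : ℂ) * u i z)
    (h0 : ∀ i, u i 0 = a)
    (hK : ∑ i, deriv (u i) 0 = 0) :
    ∑ i, u i 1 / (φ i 1 : ℂ) = a * ∑ i, (χ i 1 : ℂ) / (φ i 1 : ℂ) := by
  have key : ∀ i, u i 1 = a * (χ i 1 : ℂ) + deriv (u i) 0 * (φ i 1 : ℂ) := by
    intro i
    rw [← h0 i]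
    have real_deriv : ∀ f : ℝ → ℝ, ContDiff ℝ 2 f →
        (∀ z ∈ Set.Icc (0:ℝ) 1, -(deriv (deriv f) z) + q i z * f z = lam * f z) →
        ∀ z ∈ Set.Icc (0:ℝ) 1, HasDerivAt (fun z => ((deriv f z : ℝ) : ℂ))
          (((q i z : ℂ) - lam) * (f z : ℂ)) z := by
      intro f hf hode z hz
      refine (hf.hasDerivAt_deriv_of_two z).2.ofReal_comp.congr_deriv ?_
      rw [show deriv (deriv f) z = (q i z - lam) * f z by linear_combination -(hode z hz)]
      push_cast
      ring
    refine eq_fundamental_solutions_combination (p := fun z => (q i z : ℂ) - lam)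
      (φ := fun z => (φ i z : ℂ)) (χ := fun z => (χ i z : ℂ)) zero_le_one
      (fun z _ => ((hu i).hasDerivAt_deriv_of_two z).1) ?_
      (fun z _ => ((hφ i).hasDerivAt_deriv_of_two z).1.ofReal_comp)
      (real_deriv _ (hφ i) (hodeφ i))
      (fun z _ => ((hχ i).hasDerivAt_deriv_of_two z).1.ofReal_comp)
      (real_deriv _ (hχ i) (hodeχ i))
      (by simp [hφ0]) (by simp [hφ0']) (by simp [hχ0]) (by simp [hχ0'])
    intro z hz
    refine ((hu i).hasDerivAt_deriv_of_two z).2.congr_deriv ?_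
    linear_combination -hode i z hz
  calc ∑ i, u i 1 / (φ i 1 : ℂ)
      = ∑ i, (a * ((χ i 1 : ℂ) / (φ i 1 : ℂ)) + deriv (u i) 0) := by
        refine Finset.sum_congr rfl fun i _ => ?_
        have hne : (φ i 1 : ℂ) ≠ 0 := Complex.ofReal_ne_zero.mpr (hφ1 i)
        rw [key i]
        field_simp
    _ = a * ∑ i, (χ i 1 : ℂ) / (φ i 1 : ℂ) := by
        rw [Finset.sum_add_distrib, hK, add_zero, Finset.mul_sum]
end

section
/- Let d ≥ 2 be an integer and λ > 0. Consider the square lattice quantum graph with vertex set ℤ^d, where for each n ∈ ℤ^d and j ∈ {1,…,d} there is an edge from n to n + eⱼ identified with [0,1]. Suppose that for each edge (n,j) there is a twice continuously differentiable function u_{n,j} : ℝ → ℂ with u_{n,j}'' = −λ·u_{n,j} on [0,1], that there is a function w : ℤ^d → ℂ with u_{n,j}(0) = w(n) and u_{n,j}(1) = w(n+eⱼ) for all n, j (continuity at vertices), and that the Kirchhoff condition ∑_{j=1}^d u_{n−eⱼ,j}'(1) − ∑_{j=1}^d u_{n,j}'(0) = 0 holds at every n ∈ ℤ^d. Then for every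 n ∈ ℤ^d, ∑_{j=1}^d (w(n+eⱼ) + w(n−eⱼ)) = 2d·cos(√λ)·w(n). -/
/-- Solutions of `f'' = -k² f` on `[0, 1]` conserve `k f(z) cos (k (a - z)) + f'(z) sin (k (a - z))`,
which at `z = a` is `k f(a)`. -/
theorem helmholtz_conserved {f : ℝ → ℂ} {k : ℝ} (hf : ContDiff ℝ 2 f)
    (hode : ∀ z ∈ Set.Icc (0 : ℝ) 1, deriv (deriv f) z = -((k ^ 2 : ℝ) : ℂ) * f z) (a : ℝ) :
    k * f 1 * (Real.cos (k * (a - 1)) : ℂ) + deriv f 1 * (Real.sin (k * (a - 1)) : ℂ)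
      = k * f 0 * (Real.cos (k * (a - 0)) : ℂ) + deriv f 0 * (Real.sin (k * (a - 0)) : ℂ) := by
  have hf' : ContDiff ℝ 1 (deriv f) := ((contDiff_succ_iff_deriv (n := 1)).1 (by simpa [one_add_one_eq_two] using hf)).2.2
  have hderiv : ∀ z ∈ Set.Icc (0 : ℝ) 1, HasDerivAt
      (fun z ↦ k * f z * (Real.cos (k * (a - z)) : ℂ) + deriv f z * (Real.sin (k * (a - z)) : ℂ))
      0 z := by
    intro z hz
    have h₁ : HasDerivAt f (deriv f z) z := (hf.differentiable two_ne_zero z).hasDerivAt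
    have h₂ : HasDerivAt (deriv f) (-((k ^ 2 : ℝ) : ℂ) * f z) z :=
      hode z hz ▸ (hf'.differentiable one_ne_zero z).hasDerivAt
    have h₃ : HasDerivAt (fun z : ℝ ↦ k * (a - z)) (k * -1) z :=
      ((hasDerivAt_id z).const_sub a).const_mul k
    refine (((h₁.const_mul (k : ℂ)).mul h₃.cos.ofReal_comp).add
      (h₂.mul h₃.sin.ofReal_comp)).congr_deriv ?_
    push_cast
    ring
  exact constant_of_has_deriv_right_zero
    (fun z hz ↦ (hderiv z hz).continuousAt.continuousWithinAt)
    (fun z hz ↦ (hderiv z (Set.Ico_subset_Icc_self hz)).hasDerivWithinAt) 1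
    (Set.right_mem_Icc.2 zero_le_one)

/-- Reduction from the free edge Laplacian to the vertex Laplacian on the square
lattice ℤ^d: a Kirchhoff solution of `-u'' = λu` on all edges restricts to the
vertices as a solution of `(-Δ_V + cos √λ) w = 0`. -/
theorem stmt_13 (d : ℕ) (hd : 2 ≤ d) (lam : ℝ) (hlam : 0 < lam)
    (u : (Fin d → ℤ) → Fin d → ℝ → ℂ)
    (hu : ∀ n j, ContDiff ℝ 2 (u n j))
    (hode : ∀ n j, ∀ z ∈ Set.Icc (0:ℝ) 1,
      deriv (deriv (u n j)) z = -(lam : ℂ) * u n j z)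
    (w : (Fin d → ℤ) → ℂ)
    (hcont0 : ∀ n j, u n j 0 = w n)
    (hcont1 : ∀ n j, u n j 1 = w (n + Pi.single j 1))
    (hK : ∀ n : Fin d → ℤ,
      (∑ j : Fin d, deriv (u (n - Pi.single j 1) j) 1)
        - (∑ j : Fin d, deriv (u n j) 0) = 0) :
    ∀ n : Fin d → ℤ,
      (∑ j : Fin d, (w (n + Pi.single j 1) + w (n - Pi.single j 1)))
        = (2 * d : ℂ) * (Real.cos (Real.sqrt lam) : ℂ) * w n := by
  intro n
  have hk : (Real.sqrt lam : ℂ) ≠ 0 := by exact_mod_cast (Real.sqrt_pos.2 hlam).ne'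
  have hode' : ∀ n j, ∀ z ∈ Set.Icc (0 : ℝ) 1,
      deriv (deriv (u n j)) z = -((Real.sqrt lam ^ 2 : ℝ) : ℂ) * u n j z := by
    simpa only [Real.sq_sqrt hlam.le] using hode
  have hout : ∀ j, Real.sqrt lam * w (n + Pi.single j 1)
      = Real.sqrt lam * w n * (Real.cos (Real.sqrt lam) : ℂ)
        + deriv (u n j) 0 * (Real.sin (Real.sqrt lam) : ℂ) := fun j ↦ by
    simpa [hcont0, hcont1] using helmholtz_conserved (hu n j) (hode' n j) 1
  have hin : ∀ j, Real.sqrt lam * w (n - Pi.single j 1)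
      = Real.sqrt lam * w n * (Real.cos (Real.sqrt lam) : ℂ)
        - deriv (u (n - Pi.single j 1) j) 1 * (Real.sin (Real.sqrt lam) : ℂ) := fun j ↦ by
    have hback : u (n - Pi.single j 1) j 1 = w n :=
      (hcont1 _ j).trans (congrArg w (sub_add_cancel _ _))
    have h := helmholtz_conserved (hu (n - Pi.single j 1) j) (hode' _ j) 0
    rw [hback, hcont0] at h
    simpa [← sub_eq_add_neg] using h.symm
  apply mul_left_cancel₀ hk
  simp only [Finset.mul_sum, mul_add, hout, hin, Finset.sum_add_distrib, Finset.sum_sub_distrib,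
    ← Finset.sum_mul, Finset.sum_const, Finset.card_univ, Fintype.card_fin, nsmul_eq_mul]
  linear_combination -(Real.sin (Real.sqrt lam) : ℂ) * hK n
end

section
/- Let λ > 0. Consider the hexagonal lattice quantum graph with vertex set ℤ² × {1,2} and, for each n ∈ ℤ², three edges identified with [0,1]: edge aₙ from (n,1) to (n,2), edge bₙ from (n,1) to (n−(1,0),2), and edge cₙ from (n,2) to (n+(0,1),1). Suppose each edge carries a twice continuously differentiable function (denoted by the edge's name) satisfying u'' = −λu on [0,1]; suppose there are w₁, w₂ : ℤ² → ℂ with aₙ(0) = bₙ(0) = w₁(n), cₙ(0) = w₂(n), aₙ(1) = w₂(n), bₙ(1) = w₂(n−(1,0)), cₙ(1) = w₁(n+(0,1)) for all n (continuity at vertices); and suppose the Kirchhoff conditions c_{n−(0,1)}'(1) − aₙ'(0) − bₙ'(0) = 0 and aₙ'(1) + b_{n+(1,0)}'(1) − cₙ'(0) = 0 hold for every n ∈ ℤ². Then for every n ∈ ℤ²: (1/3)·(w₂(n) + w₂(n−(1,0)) + w₂(n−(0,1))) = cos(√λ)·w₁(n) and (1/3)·(w₁(n) + w₁(n+(1,0))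 + w₁(n+(0,1))) = cos(√λ)·w₂(n). -/
/-- For `u'' = -k² u`, the quantity `k cos (k z + t) u z - sin (k z + t) u' z` takes the same
value at both endpoints of `[0, 1]`, for every phase `t`. -/
theorem cos_mul_sub_sin_mul_deriv_eq {u : ℝ → ℂ} {k : ℝ} (hu : ContDiff ℝ 2 u)
    (hode : ∀ z ∈ Set.Icc (0 : ℝ) 1, deriv (deriv u) z = -((k ^ 2 : ℝ) : ℂ) * u z) (t : ℝ) :
    k * Real.cos (k + t) * u 1 - Real.sin (k + t) * deriv u 1
      = k * Real.cos t * u 0 - Real.sin t * deriv u 0 := by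
  have hd (z : ℝ) : HasDerivAt u (deriv u z) z :=
    (hu.differentiable (by norm_num) z).hasDerivAt
  have hdd (z : ℝ) : HasDerivAt (deriv u) (deriv (deriv u) z) z :=
    ((ContDiff.differentiable_deriv_two hu) z).hasDerivAt
  have hlin (z : ℝ) : HasDerivAt (fun x : ℝ => k * x + t) k z := by
    simpa using ((hasDerivAt_id z).const_mul k).add_const t
  have hg (z : ℝ) := (((hlin z).cos.ofReal_comp.const_mul (k : ℂ)).mul (hd z)).sub
    ((hlin z).sin.ofReal_comp.mul (hdd z))
  have hconst := constant_of_has_deriv_right_zero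
    (fun z _ => (hg z).continuousAt.continuousWithinAt) (a := 0) (b := 1)
    (fun z hz => by
      refine ((hg z).congr_deriv ?_).hasDerivWithinAt
      rw [hode z ⟨hz.1, hz.2.le⟩]
      push_cast
      ring) 1 (by simp)
  simpa using hconst

/-- The value at `1` of a solution of `u'' = -k² u` in terms of its Cauchy data at `0`. -/
theorem mul_apply_one_eq {u : ℝ → ℂ} {k : ℝ} (hu : ContDiff ℝ 2 u)
    (hode : ∀ z ∈ Set.Icc (0 : ℝ) 1, deriv (deriv u) z = -((k ^ 2 : ℝ) : ℂ) * u z) :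
    (k : ℂ) * u 1 = k * (Real.cos k : ℂ) * u 0 + (Real.sin k : ℂ) * deriv u 0 := by
  simpa using cos_mul_sub_sin_mul_deriv_eq hu hode (-k)

/-- The value at `0` of a solution of `u'' = -k² u` in terms of its Cauchy data at `1`. -/
theorem mul_apply_zero_eq {u : ℝ → ℂ} {k : ℝ} (hu : ContDiff ℝ 2 u)
    (hode : ∀ z ∈ Set.Icc (0 : ℝ) 1, deriv (deriv u) z = -((k ^ 2 : ℝ) : ℂ) * u z) :
    (k : ℂ) * u 0 = k * (Real.cos k : ℂ) * u 1 - (Real.sin k : ℂ) * deriv u 1 := by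
  simpa using (cos_mul_sub_sin_mul_deriv_eq hu hode 0).symm

/-- Reduction from the free edge Laplacian to the vertex Laplacian on the
hexagonal lattice: a Kirchhoff solution of `-u'' = λu` on all edges restricts to
the vertices as a solution of the discrete Helmholtz equation
`(-Δ_V + cos √λ) w = 0`. -/
theorem stmt_14 (lam : ℝ) (hlam : 0 < lam)
    (a b c : ℤ × ℤ → ℝ → ℂ)
    (ha : ∀ n, ContDiff ℝ 2 (a n)) (hb : ∀ n, ContDiff ℝ 2 (b n))
    (hc : ∀ n, ContDiff ℝ 2 (c n))
    (hodea : ∀ n, ∀ z ∈ Set.Icc (0:ℝ) 1, deriv (deriv (a n)) z = -(lam : ℂ) * a n z)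
    (hodeb : ∀ n, ∀ z ∈ Set.Icc (0:ℝ) 1, deriv (deriv (b n)) z = -(lam : ℂ) * b n z)
    (hodec : ∀ n, ∀ z ∈ Set.Icc (0:ℝ) 1, deriv (deriv (c n)) z = -(lam : ℂ) * c n z)
    (w₁ w₂ : ℤ × ℤ → ℂ)
    (ha0 : ∀ n, a n 0 = w₁ n) (hb0 : ∀ n, b n 0 = w₁ n) (hc0 : ∀ n, c n 0 = w₂ n)
    (ha1 : ∀ n, a n 1 = w₂ n) (hb1 : ∀ n, b n 1 = w₂ (n - ((1, 0) : ℤ × ℤ)))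
    (hc1 : ∀ n, c n 1 = w₁ (n + ((0, 1) : ℤ × ℤ)))
    (hK1 : ∀ n : ℤ × ℤ,
      deriv (c (n - ((0, 1) : ℤ × ℤ))) 1 - deriv (a n) 0 - deriv (b n) 0 = 0)
    (hK2 : ∀ n : ℤ × ℤ,
      deriv (a n) 1 + deriv (b (n + ((1, 0) : ℤ × ℤ))) 1 - deriv (c n) 0 = 0) :
    ∀ n : ℤ × ℤ,
      (1 / 3 : ℂ) * (w₂ n + w₂ (n - ((1, 0) : ℤ × ℤ)) + w₂ (n - ((0, 1) : ℤ × ℤ)))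
          = (Real.cos (Real.sqrt lam) : ℂ) * w₁ n
        ∧ (1 / 3 : ℂ) * (w₁ n + w₁ (n + ((1, 0) : ℤ × ℤ)) + w₁ (n + ((0, 1) : ℤ × ℤ)))
          = (Real.cos (Real.sqrt lam) : ℂ) * w₂ n := by
  obtain ⟨k, hk⟩ : ∃ k, k = Real.sqrt lam := ⟨_, rfl⟩
  have hk0 : (k : ℂ) ≠ 0 := by
    rw [hk]
    exact_mod_cast (Real.sqrt_pos.2 hlam).ne'
  have hlam_eq : lam = k ^ 2 := by rw [hk, Real.sq_sqrt hlam.le]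
  rw [← hk]
  rw [hlam_eq] at hodea hodeb hodec
  intro n
  constructor
  · have h1 := mul_apply_one_eq (ha n) (hodea n)
    have h2 := mul_apply_one_eq (hb n) (hodeb n)
    have h3 := mul_apply_zero_eq (hc (n - (0, 1))) (hodec _)
    rw [ha0, ha1] at h1
    rw [hb0, hb1] at h2
    rw [hc0, hc1, sub_add_cancel] at h3
    apply mul_left_cancel₀ hk0
    linear_combination (h1 + h2 + h3 - (Real.sin k : ℂ) * hK1 n) / 3
  · have h1 := mul_apply_zero_eq (ha n) (hodea n)
    have h2 := mul_apply_zero_eq (hb (n + (1, 0))) (hodeb _)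
    have h3 := mul_apply_one_eq (hc n) (hodec n)
    rw [ha0, ha1] at h1
    rw [hb0, hb1, add_sub_cancel_right] at h2
    rw [hc0, hc1] at h3
    apply mul_left_cancel₀ hk0
    linear_combination (h1 + h2 + h3 - (Real.sin k : ℂ) * hK2 n) / 3
end

section
/- Let d ≥ 2 be an integer, λ ∈ ℝ, and consider the square lattice quantum graph with vertex set ℤ^d, where for each n ∈ ℤ^d and j ∈ {1,…,d} there is an edge from n to n + eⱼ identified with [0,1], carrying a continuous potential q_{n,j} : ℝ → ℝ. Assume that for every edge (n,j), the only twice continuously differentiable function v on [0,1] with −v'' + q_{n,j}v = λv and v(0) = v(1) = 0 is v ≡ 0 on [0,1]. Suppose that for each edge (n,j) there is a twice continuously differentiable u_{n,j} : ℝ → ℂ with −u_{n,j}'' + q_{n,j}u_{n,j} = λ·u_{n,j} on [0,1], that there is w : ℤ^d → ℂ with u_{n,j}(0) = w(n) and u_{n,j}(1) = w(n+eⱼ) for all n, j, and that the Kirchhoff condition ∑_{j=1}^d u_{n−eⱼ,j}'(1) − ∑_{j=1}^d u_{n,j}'(0) = 0 holds at every n ∈ ℤ^d. If there is an integer k such that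 u_{n,j} ≡ 0 on [0,1] for every edge (n,j) with n_d > k (all edges lying in the half-space {x_d > k}), then u_{n,j} ≡ 0 on [0,1] for every edge (n,j). -/
open Set in
/-- A function vanishing on a nondegenerate compact interval has zero derivative there. -/
theorem deriv_eq_zero_of_eqOn_Icc_zero {E : Type*} [NormedAddCommGroup E] [NormedSpace ℝ E]
    {f : ℝ → E} {a b t : ℝ} (hab : a < b) (ht : t ∈ Icc a b) (hf : DifferentiableAt ℝ f t)
    (h : ∀ z ∈ Icc a b, f z = 0) : deriv f t = 0 := by
  rw [← hf.derivWithin (uniqueDiffOn_Icc hab t ht), derivWithin_congr h (h t ht)]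
  simp

open Set in
/-- Backward uniqueness for the initial value problem of the scalar equation `f'' = p f`. -/
theorem eqOn_zero_of_deriv_deriv_eq_smul {E : Type*} [NormedAddCommGroup E] [NormedSpace ℝ E]
    {f : ℝ → E} {p : ℝ → ℝ} {a b : ℝ} (hf : ContDiff ℝ 2 f) (hp : ContinuousOn p (Icc a b))
    (hode : ∀ z ∈ Icc a b, deriv (deriv f) z = p z • f z)
    (hb : f b = 0) (hb' : deriv f b = 0) : ∀ z ∈ Icc a b, f z = 0 := by
  obtain ⟨C, hC⟩ := isCompact_Icc.exists_bound_of_continuousOn hp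
  have hf1 : ContDiff ℝ 1 (deriv f) := hf.deriv'
  have hdf : Differentiable ℝ f := hf.differentiable (by norm_num)
  have hdf' : Differentiable ℝ (deriv f) := hf1.differentiable (by norm_num)
  have key := ODE_solution_unique_of_mem_Icc_left (a := a) (b := b)
    (v := fun t (x : E × E) => (x.2, p t • x.1)) (s := fun _ => univ)
    (K := max 1 C.toNNReal) (f := fun t => (f t, deriv f t)) (g := fun _ => 0)
    (fun t ht => LipschitzWith.lipschitzOnWith <| .prodMk .prod_snd <| by
      refine LipschitzWith.of_dist_le_mul fun x y => ?_
      rw [dist_eq_norm, ← smul_sub, norm_smul, dist_eq_norm]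
      gcongr
      · exact (hC t (Ioc_subset_Icc_self ht)).trans (Real.le_coe_toNNReal C)
      · exact norm_fst_le (x - y))
    (hdf.continuous.prodMk hdf'.continuous).continuousOn
    (fun t ht => ?_) (fun _ _ => mem_univ _) continuousOn_const
    (fun t _ => by
      simpa [← Prod.zero_eq_mk] using hasDerivWithinAt_const t (Iic t) (0 : E × E))
    (fun _ _ => mem_univ _) (by simp [hb, hb'])
  · intro z hz
    exact congrArg Prod.fst (key hz)
  · rw [← hode t (Ioc_subset_Icc_self ht)]
    exact ((hdf t).hasDerivAt.prodMk (hdf' t).hasDerivAt).hasDerivWithinAt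

/-- A continuous linear map over `ℝ` commutes with the second derivative of a `C²` curve. -/
theorem ContinuousLinearMap.deriv_deriv_comp {E F : Type*} [NormedAddCommGroup E]
    [NormedSpace ℝ E] [NormedAddCommGroup F] [NormedSpace ℝ F] (L : E →L[ℝ] F) {f : ℝ → E}
    (hf : ContDiff ℝ 2 f) (z : ℝ) :
    deriv (deriv fun t => L (f t)) z = L (deriv (deriv f) z) := by
  have hf1 : ContDiff ℝ 1 (deriv f) := hf.deriv'
  have hd : deriv (fun t => L (f t)) = fun t => L (deriv f t) := by
    ext t
    exact (L.hasFDerivAt.comp_hasDerivAt t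
      (hf.differentiable (by norm_num) t).hasDerivAt).deriv
  rw [hd]
  exact (L.hasFDerivAt.comp_hasDerivAt z
    (hf1.differentiable (by norm_num) z).hasDerivAt).deriv

open Set in
/-- If the real Dirichlet problem on `[0, 1]` has only the trivial solution, then so does the
complex one. -/
theorem eqOn_zero_of_real_dirichlet {q : ℝ → ℝ} {lam : ℝ}
    (hDir : ∀ v : ℝ → ℝ, ContDiff ℝ 2 v →
      (∀ z ∈ Icc (0 : ℝ) 1, -(deriv (deriv v) z) + q z * v z = lam * v z) →
      v 0 = 0 → v 1 = 0 → ∀ z ∈ Icc (0 : ℝ) 1, v z = 0)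
    {f : ℝ → ℂ} (hf : ContDiff ℝ 2 f)
    (hode : ∀ z ∈ Icc (0 : ℝ) 1,
      -(deriv (deriv f) z) + (q z : ℂ) * f z = (lam : ℂ) * f z)
    (h0 : f 0 = 0) (h1 : f 1 = 0) : ∀ z ∈ Icc (0 : ℝ) 1, f z = 0 := by
  intro z hz
  apply Complex.ext
  · refine hDir (fun t => Complex.reCLM (f t)) (Complex.reCLM.contDiff.comp hf)
      (fun t ht => ?_) (by simp [h0]) (by simp [h1]) z hz
    rw [Complex.reCLM.deriv_deriv_comp hf]
    simpa using congrArg Complex.re (hode t ht)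
  · refine hDir (fun t => Complex.imCLM (f t)) (Complex.imCLM.contDiff.comp hf)
      (fun t ht => ?_) (by simp [h0]) (by simp [h1]) z hz
    rw [Complex.imCLM.deriv_deriv_comp hf]
    simpa using congrArg Complex.im (hode t ht)


/-- Unique continuation property for the square lattice quantum graph: a Kirchhoff
solution of the edge Schrödinger equation vanishing on all edges in a half-space
`{x_d > k}` vanishes identically, provided `λ` is not a Dirichlet eigenvalue on
any edge. -/
theorem stmt_15 (d : ℕ) (hd : 2 ≤ d) (lam : ℝ)
    (q : (Fin d → ℤ) → Fin d → ℝ → ℝ)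
    (hq : ∀ n j, Continuous (q n j))
    (hDir : ∀ (n : Fin d → ℤ) (j : Fin d) (v : ℝ → ℝ), ContDiff ℝ 2 v →
      (∀ z ∈ Set.Icc (0:ℝ) 1,
        -(deriv (deriv v) z) + q n j z * v z = lam * v z) →
      v 0 = 0 → v 1 = 0 → ∀ z ∈ Set.Icc (0:ℝ) 1, v z = 0)
    (u : (Fin d → ℤ) → Fin d → ℝ → ℂ)
    (hu : ∀ n j, ContDiff ℝ 2 (u n j))
    (hode : ∀ n j, ∀ z ∈ Set.Icc (0:ℝ) 1,
      -(deriv (deriv (u n j)) z) + (q n j z : ℂ) * u n j z = (lam : ℂ) * u n j z)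
    (w : (Fin d → ℤ) → ℂ)
    (hcont0 : ∀ n j, u n j 0 = w n)
    (hcont1 : ∀ n j, u n j 1 = w (n + Pi.single j 1))
    (hK : ∀ n : Fin d → ℤ,
      (∑ j : Fin d, deriv (u (n - Pi.single j 1) j) 1)
        - (∑ j : Fin d, deriv (u n j) 0) = 0)
    (k : ℤ)
    (hvanish : ∀ (n : Fin d → ℤ) (j : Fin d), k < n ⟨d - 1, by omega⟩ →
      ∀ z ∈ Set.Icc (0:ℝ) 1, u n j z = 0) :
    ∀ (n : Fin d → ℤ) (j : Fin d), ∀ z ∈ Set.Icc (0:ℝ) 1, u n j z = 0 := by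
  set l : Fin d := ⟨d - 1, by omega⟩
  have hdiff : ∀ n j, Differentiable ℝ (u n j) := fun n j =>
    (hu n j).differentiable (by norm_num)
  have step : ∀ m : ℤ,
      (∀ (n : Fin d → ℤ) (j : Fin d), m < n l → ∀ z ∈ Set.Icc (0:ℝ) 1, u n j z = 0) →
      ∀ (n : Fin d → ℤ) (j : Fin d), m - 1 < n l → ∀ z ∈ Set.Icc (0:ℝ) 1, u n j z = 0 := by
    intro m hm
    have hw : ∀ n : Fin d → ℤ, m < n l → w n = 0 := fun n hn => by
      rw [← hcont0 n l]
      exact hm n l hn 0 (by simp)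
    have hvert : ∀ n : Fin d → ℤ, m - 1 < n l → ∀ z ∈ Set.Icc (0:ℝ) 1, u n l z = 0 := by
      intro n hn
      have hn' : m < (n + Pi.single l 1 : Fin d → ℤ) l := by
        rw [Pi.add_apply, Pi.single_eq_same]
        omega
      have hout : ∑ j : Fin d, deriv (u (n + Pi.single l 1) j) 0 = 0 :=
        Finset.sum_eq_zero fun j _ => deriv_eq_zero_of_eqOn_Icc_zero zero_lt_one (by simp)
          (hdiff _ _ _) (hm _ j hn')
      have hin := hK (n + Pi.single l 1)
      rw [hout, sub_zero, Finset.sum_eq_single l, add_sub_cancel_right] at hin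
      · refine eqOn_zero_of_deriv_deriv_eq_smul (p := fun z => q n l z - lam) (hu n l)
          ((hq n l).sub continuous_const).continuousOn (fun z hz => ?_)
          ((hcont1 n l).trans (hw _ hn')) hin
        rw [Complex.real_smul]
        push_cast
        linear_combination -hode n l z hz
      · intro j _ hj
        refine deriv_eq_zero_of_eqOn_Icc_zero zero_lt_one (by simp) (hdiff _ _ _) (hm _ j ?_)
        rwa [Pi.sub_apply, Pi.single_eq_of_ne hj.symm, sub_zero]
      · simp
    have hw' : ∀ n : Fin d → ℤ, m - 1 < n l → w n = 0 := fun n hn => by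
      rw [← hcont0 n l]
      exact hvert n hn 0 (by simp)
    intro n j hn
    refine eqOn_zero_of_real_dirichlet (hDir n j) (hu n j) (hode n j)
      ((hcont0 n j).trans (hw' n hn)) ((hcont1 n j).trans (hw' _ ?_))
    have : (0 : ℤ) ≤ (Pi.single j 1 : Fin d → ℤ) l :=
      (Pi.single_nonneg.2 zero_le_one : (0 : Fin d → ℤ) ≤ Pi.single j 1) l
    rw [Pi.add_apply]
    omega
  have hall : ∀ i : ℕ, ∀ (n : Fin d → ℤ) (j : Fin d), k - i < n l →
      ∀ z ∈ Set.Icc (0:ℝ) 1, u n j z = 0 := by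
    intro i
    induction i with
    | zero => simpa using hvanish
    | succ i ih =>
      intro n j hn
      exact step _ ih n j (by push_cast at hn; omega)
  intro n j
  exact hall (k - n l + 1).toNat n j (by omega)
end
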